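/- Let G be a 7-contraction-critical graph with no K7^∨-minor. Then any two distinct cliques of G of size five intersect in at most two vertices. -/

import Mathlib

open SimpleGraph

/-- `K7vee` is the graph obtained from `K 7` by deleting two edges with a common end. -/
def K7vee : SimpleGraph (Fin 7) :=
  (completeGraph (Fin 7)).deleteEdges {s(0, 1), s(0, 2)}

/-- `K6vee` is the graph obtained from `K 6` by deleting two edges with a common end. -/
def K6vee : SimpleGraph (Fin 6) :=
  (completeGraph (Fin 6)).deleteEdges {s(0, 1), s(0, 2)}

/-- The complete multipartite graph with four parts of size two. -/
def K2222 : SimpleGraph (Fin 4 × Fin 2) :=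
  SimpleGraph.comap Prod.fst (completeGraph (Fin 4))

/-- `H` is a minor of `G`: there is a model of `H` in `G`, i.e. a family of pairwise disjoint
nonempty connected branch sets, one for each vertex of `H`, with edges of `G` between branch
sets corresponding to adjacent vertices of `H`. -/
def IsMinor {W V : Type} (H : SimpleGraph W) (G : SimpleGraph V) : Prop :=
  ∃ bag : W → Set V,
    (∀ w, (G.induce (bag w)).Connected) ∧
    (∀ w w', w ≠ w' → Disjoint (bag w) (bag w')) ∧
    (∀ w w', H.Adj w w' → ∃ u ∈ bag w, ∃ v ∈ bag w', G.Adj u v)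

/-- A graph is `k`-connected if it has more than `k` vertices and stays connected after
removing any set of fewer than `k` vertices. -/
def IsKConnected {V : Type} [Fintype V] (k : ℕ) (G : SimpleGraph V) : Prop :=
  k < Fintype.card V ∧ ∀ S : Set V, S.ncard < k → (G.induce (Sᶜ : Set V)).Connected

/-- A separation of `G`: `A ∪ B = V(G)` and no edge joins `A - B` to `B - A`. -/
def IsSeparation {V : Type} (G : SimpleGraph V) (A B : Set V) : Prop :=
  A ∪ B = Set.univ ∧ ∀ ⦃u v : V⦄, G.Adj u v → ¬(u ∈ A \ B ∧ v ∈ B \ A)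

/-- `(G, Z)` is internally `k`-connected: every separation `(A,B)` of `G` with `Z ⊆ A`
and `B - A ≠ ∅` has order at least `k`. -/
def InternallyConnected {V : Type} (G : SimpleGraph V) (Z : Set V) (k : ℕ) : Prop :=
  ∀ A B : Set V, IsSeparation G A B → Z ⊆ A → (B \ A).Nonempty →
    k ≤ (A ∩ B).ncard

/-- A `Z`-rooted `K₄`-model in `G`. -/
def HasRootedK4Model {V : Type} (G : SimpleGraph V) (Z : Set V) : Prop :=
  ∃ B : Fin 4 → Set V,
    (∀ i, (G.induce (B i)).Connected) ∧
    (∀ i j, i ≠ j → Disjoint (B i) (B j)) ∧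
    (∀ i, ∃! z : V, z ∈ Z ∧ z ∈ B i) ∧
    (∀ z ∈ Z, ∃ i, z ∈ B i) ∧
    (∀ i j, i ≠ j → ∃ u ∈ B i, ∃ v ∈ B j, G.Adj u v)

/-- A `Z`-rooted `K*₄,₂`-model in `G`. -/
def HasRootedK42starModel {V : Type} (G : SimpleGraph V) (Z : Set V) : Prop :=
  ∃ (B : Fin 4 → Set V) (C : Fin 2 → Set V),
    (∀ i, (G.induce (B i)).Connected) ∧
    (∀ j, (G.induce (C j)).Connected) ∧
    (∀ i j, i ≠ j → Disjoint (B i) (B j)) ∧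
    (∀ i j, i ≠ j → Disjoint (C i) (C j)) ∧
    (∀ i j, Disjoint (B i) (C j)) ∧
    (∀ i, ∃! z : V, z ∈ Z ∧ z ∈ B i) ∧
    (∀ z ∈ Z, ∃ i, z ∈ B i) ∧
    (∀ i j, ∃ u ∈ B i, ∃ v ∈ C j, G.Adj u v) ∧
    (∃ u ∈ C 0, ∃ v ∈ C 1, G.Adj u v)

/-- An enemy: a `4`-connected graph with `|E(G)| ≥ 4|V(G)| - 8`, with no `K7vee`-minor,
not isomorphic to `K_{2,2,2,2}`. -/
def Enemy {V : Type} [Fintype V] (G : SimpleGraph V) : Prop :=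
  IsKConnected 4 G ∧
    4 * (Fintype.card V : ℤ) - 8 ≤ (G.edgeSet.ncard : ℤ) ∧
    ¬ IsMinor K7vee G ∧
    IsEmpty (G ≃g K2222)

/-- A minor-minimal enemy: an enemy, no minor of which, other than itself, is an enemy. -/
def MinorMinimalEnemy {V : Type} [Fintype V] (G : SimpleGraph V) : Prop :=
  Enemy G ∧ ∀ (W : Type) [Fintype W] (H : SimpleGraph W),
    IsMinor H G → Enemy H → Nonempty (H ≃g G)

/-- The simple graph obtained from `G` by contracting the edge `uv`
(`v` is merged into `u`). -/
def contractEdge {V : Type} (G : SimpleGraph V) (u v : V) :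
    SimpleGraph {x : V // x ≠ v} :=
  SimpleGraph.fromRel (fun x y => G.Adj ↑x ↑y ∨ ((x : V) = u ∧ G.Adj v ↑y))

/-- A graph is `7`-contraction-critical if its chromatic number is `7` and
every minor of it, other than itself, has chromatic number less than `7`. -/
def ContractionCritical7 {V : Type} [Fintype V] (G : SimpleGraph V) : Prop :=
  G.chromaticNumber = 7 ∧
    ∀ (W : Type) [Fintype W] (H : SimpleGraph W),
      IsMinor H G → IsEmpty (H ≃g G) → H.chromaticNumber < 7

namespace ContractionCritical7

variable {V : Type} [Fintype V] {G : SimpleGraph V}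

lemma not_colorable_six (hcrit : ContractionCritical7 G) : ¬ G.Colorable 6 := by
  intro h
  have h6 := h.chromaticNumber_le
  rw [hcrit.1] at h6
  exact absurd h6 (by decide)

lemma colorable_six_of_isMinor (hcrit : ContractionCritical7 G) {W : Type} [Fintype W]
    {H : SimpleGraph W} (hH : IsMinor H G) (hcard : Fintype.card W < Fintype.card V) :
    H.Colorable 6 := by
  have h := hcrit.2 W H hH ⟨fun e => hcard.ne (Fintype.card_congr e.toEquiv)⟩
  exact SimpleGraph.chromaticNumber_le_iff_colorable.1 (Order.le_of_lt_add_one h)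

lemma exists_coloring_on (hcrit : ContractionCritical7 G) {A : Set V} (hA : A ≠ Set.univ) :
    ∃ f : V → Fin 6, ∀ u ∈ A, ∀ v ∈ A, G.Adj u v → f u ≠ f v := by
  classical
  obtain ⟨z, hz⟩ := (Set.ne_univ_iff_exists_notMem A).1 hA
  have hminor : IsMinor (G.induce A) G := by
    refine ⟨fun w => {w.1}, fun w => ?_, fun w w' h => ?_, fun w w' h => ?_⟩
    · exact SimpleGraph.Connected.of_subsingleton
    · simpa using fun h' => h (Subtype.ext h')
    · exact ⟨w, rfl, w', rfl, h⟩
  obtain ⟨c⟩ := hcrit.colorable_six_of_isMinor hminor (Fintype.card_subtype_lt hz)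
  refine ⟨fun v => if h : v ∈ A then c ⟨v, h⟩ else 0, fun u hu v hv huv => ?_⟩
  simp only [hu, hv, dif_pos]
  exact c.valid huv

/-- Contracting a connected set outside `A` onto one of its two neighbours `a` and `b` in `A`
yields a colouring of `A` that separates `a` from `b`. -/
lemma exists_coloring_on_ne (hcrit : ContractionCritical7 G) {A X : Set V} {a b : V}
    (ha : a ∈ A) (hb : b ∈ A) (hab : a ≠ b) (hX : (G.induce X).Connected)
    (hXA : ∀ x ∈ X, x ∉ A) (hXa : ∃ x ∈ X, G.Adj x a) (hXb : ∃ x ∈ X, G.Adj x b) :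
    ∃ f : V → Fin 6, (∀ u ∈ A, ∀ v ∈ A, G.Adj u v → f u ≠ f v) ∧ f a ≠ f b := by
  classical
  obtain ⟨x, hx, hxa⟩ := hXa
  obtain ⟨y, hy, hyb⟩ := hXb
  let H : SimpleGraph A := G.induce A ⊔ SimpleGraph.edge ⟨a, ha⟩ ⟨b, hb⟩
  have hminor : IsMinor H G := by
    refine ⟨fun w => if w.1 = a then {a} ∪ X else {w.1}, fun w => ?_, fun w w' h => ?_,
      fun w w' h => ?_⟩
    · dsimp only
      by_cases hw : w.1 = a
      · rw [if_pos hw]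
        exact SimpleGraph.connected_induce_union (s := {a})
          (SimpleGraph.Connected.of_subsingleton).preconnected hX.preconnected rfl hx hxa.symm
      · rw [if_neg hw]
        exact SimpleGraph.Connected.of_subsingleton
    · have hw := w.2
      have hw' := w'.2
      have hne : w.1 ≠ w'.1 := fun h' => h (Subtype.ext h')
      rw [Set.disjoint_left]
      intro v
      dsimp only
      split_ifs <;> simp <;> grind
    · have hmem : ∀ u : A, u.1 ∈ (if u.1 = a then {a} ∪ X else {u.1} : Set V) := by
        intro u
        split_ifs with hu <;> simp [hu]
      have hmem' : y ∈ (if a = a then {a} ∪ X else {a} : Set V) := by simp [hy]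
      rcases h with h | h
      · exact ⟨w, hmem w, w', hmem w', h⟩
      · rw [SimpleGraph.edge_adj] at h
        rcases h.1 with ⟨rfl, rfl⟩ | ⟨rfl, rfl⟩
        · exact ⟨y, hmem', b, hmem ⟨b, hb⟩, hyb⟩
        · exact ⟨b, hmem ⟨b, hb⟩, y, hmem', hyb.symm⟩
  obtain ⟨c⟩ := hcrit.colorable_six_of_isMinor hminor (Fintype.card_subtype_lt (hXA x hx))
  refine ⟨fun v => if h : v ∈ A then c ⟨v, h⟩ else 0, fun u hu v hv huv => ?_, ?_⟩
  · simp only [hu, hv, dif_pos]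
    exact c.valid (Or.inl huv)
  · simp only [ha, hb, dif_pos]
    refine c.valid (Or.inr ?_)
    rw [SimpleGraph.edge_adj]
    exact ⟨Or.inl ⟨rfl, rfl⟩, fun h => hab (congrArg Subtype.val h)⟩

end ContractionCritical7

section Coloring

variable {V : Type} {G : SimpleGraph V}

lemma colorable_of_injOn_separator {n : ℕ} {S X : Set V} {f g : V → Fin n}
    (hout : ∀ x ∈ X, ∀ y, y ∉ X → y ∉ S → ¬ G.Adj x y)
    (hf : ∀ u ∈ Xᶜ, ∀ v ∈ Xᶜ, G.Adj u v → f u ≠ f v)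
    (hg : ∀ u ∈ X ∪ S, ∀ v ∈ X ∪ S, G.Adj u v → g u ≠ g v)
    (hfS : Set.InjOn f S) (hgS : Set.InjOn g S) :
    G.Colorable n := by
  classical
  have hfin : Finite S := Finite.of_injective (fun s : S => f s) fun s t h =>
    Subtype.ext (hfS s.2 t.2 h)
  obtain ⟨σ, hσ⟩ := Equiv.Perm.exists_extending_pair (fun s : S => g s) (fun s : S => f s)
    (fun s t h => Subtype.ext (hgS s.2 t.2 h)) (fun s t h => Subtype.ext (hfS s.2 t.2 h))
  have hσ' : ∀ s ∈ S, σ (g s) = f s := fun s hs => hσ ⟨s, hs⟩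
  have key : ∀ u ∈ X, ∀ v, v ∉ X → G.Adj u v → σ (g u) ≠ f v := by
    intro u hu v hv huv
    by_cases hvS : v ∈ S
    · rw [← hσ' v hvS]
      exact fun h => hg u (Or.inl hu) v (Or.inr hvS) huv (σ.injective h)
    · exact absurd huv (hout u hu v hv hvS)
  refine ⟨SimpleGraph.Coloring.mk (fun v => if v ∈ X then σ (g v) else f v) fun {u v} huv => ?_⟩
  by_cases hu : u ∈ X <;> by_cases hv : v ∈ X <;> simp only [hu, hv, if_true, if_false]
  · exact fun h => hg u (Or.inl hu) v (Or.inl hv) huv (σ.injective h)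
  · exact key u hu v hv huv
  · exact (key v hv u hu huv.symm).symm
  · exact hf u hu v hv huv

lemma exists_connected_subset_closed [Finite V] (G : SimpleGraph V) {D : Set V}
    (hD : D.Nonempty) :
    ∃ X ⊆ D, (G.induce X).Connected ∧ ∀ x ∈ X, ∀ y ∈ D, G.Adj x y → y ∈ X := by
  obtain ⟨d, hd⟩ := hD
  obtain ⟨X, hX⟩ := (Set.toFinite {X : Set V | X ⊆ D ∧ (G.induce X).Connected}).exists_maximal
    ⟨{d}, by simpa using hd, SimpleGraph.Connected.of_subsingleton⟩
  refine ⟨X, hX.1.1, hX.1.2, fun x hx y hy hxy => ?_⟩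
  have hXy : X ∪ {y} ∈ {X : Set V | X ⊆ D ∧ (G.induce X).Connected} :=
    ⟨Set.union_subset hX.1.1 (by simpa using hy), SimpleGraph.connected_induce_union
      hX.1.2.preconnected (SimpleGraph.Connected.of_subsingleton).preconnected hx rfl hxy⟩
  exact hX.2 hXy Set.subset_union_left (Or.inr rfl)

end Coloring

namespace ContractionCritical7

variable {V : Type} [Fintype V] {G : SimpleGraph V}

/-- No clique separates a 7-contraction-critical graph. -/
lemma exists_adj_of_isClique (hcrit : ContractionCritical7 G) {S X : Set V} (hS : G.IsClique S)
    (hX : X.Nonempty) (hXS : ∀ x ∈ X, x ∉ S) {z : V} (hzS : z ∉ S) (hzX : z ∉ X) :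
    ∃ x ∈ X, ∃ y, y ∉ X ∧ y ∉ S ∧ G.Adj x y := by
  by_contra! h
  obtain ⟨x, hx⟩ := hX
  obtain ⟨f, hf⟩ := hcrit.exists_coloring_on (A := Xᶜ)
    ((Set.ne_univ_iff_exists_notMem _).2 ⟨x, fun h => h hx⟩)
  obtain ⟨g, hg⟩ := hcrit.exists_coloring_on (A := X ∪ S)
    ((Set.ne_univ_iff_exists_notMem _).2 ⟨z, by simp [hzS, hzX]⟩)
  refine hcrit.not_colorable_six (colorable_of_injOn_separator h hf hg ?_ ?_)
  · intro s hs t ht hst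
    by_contra hne
    exact hf s (fun h => hXS s h hs) t (fun h => hXS t h ht) (hS hs ht hne) hst
  · intro s hs t ht hst
    by_contra hne
    exact hg s (Or.inr hs) t (Or.inr ht) (hS hs ht hne) hst

/-- A set that is a clique up to one missing edge does not separate a
7-contraction-critical graph. -/
lemma exists_adj_of_isClique_up_to_edge (hcrit : ContractionCritical7 G) {S X : Set V} {a b : V}
    (hS : ∀ s ∈ S, ∀ t ∈ S, s ≠ t → G.Adj s t ∨ s = a ∧ t = b ∨ s = b ∧ t = a)
    (hX : X.Nonempty) (hXS : ∀ x ∈ X, x ∉ S) {z : V} (hzS : z ∉ S) (hzX : z ∉ X) :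
    ∃ x ∈ X, ∃ y, y ∉ X ∧ y ∉ S ∧ G.Adj x y := by
  by_cases hclique : G.IsClique S
  · exact hcrit.exists_adj_of_isClique hclique hX hXS hzS hzX
  obtain ⟨ha, hb, hab⟩ : a ∈ S ∧ b ∈ S ∧ a ≠ b := by
    simp only [SimpleGraph.IsClique, Set.Pairwise] at hclique
    push Not at hclique
    obtain ⟨s, hs, t, ht, hst, hadj⟩ := hclique
    rcases hS s hs t ht hst with h | ⟨rfl, rfl⟩ | ⟨rfl, rfl⟩
    · exact absurd h hadj
    · exact ⟨hs, ht, hst⟩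
    · exact ⟨ht, hs, hst.symm⟩
  have hadj : ∀ c ∈ S, (c = a ∨ c = b) → ∀ D Y : Set V, (∀ x ∈ D, x ∉ S) → Y ⊆ D →
      Y.Nonempty → (∀ x ∈ Y, ∀ y ∈ D, G.Adj x y → y ∈ Y) →
      (∀ x ∈ D, ∀ y, y ∉ D → y ∉ S → ¬ G.Adj x y) → ∃ x ∈ Y, G.Adj x c := by
    intro c hc hcab D Y hDS hYD hY hYcl hDout
    have hcl : G.IsClique (S \ {c}) := by
      intro s hs t ht hst
      have := hS s hs.1 t ht.1 hst
      have h1 : s ≠ c := hs.2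
      have h2 : t ≠ c := ht.2
      grind
    obtain ⟨x, hx, y, hyY, hyS, hxy⟩ := hcrit.exists_adj_of_isClique hcl hY
      (fun x hx h => hDS x (hYD hx) h.1) (z := c) (by simp) (fun h => hDS c (hYD h) hc)
    refine ⟨x, hx, ?_⟩
    have hyD : y ∉ D := fun h => hyY (hYcl x hx y h hxy)
    by_cases hy : y ∈ S
    · have : y = c := by
        by_contra hne
        exact hyS ⟨hy, hne⟩
      exact this ▸ hxy
    · exact absurd hxy (hDout x (hYD hx) y hyD hy)
  have hcol : ∀ D : Set V, D.Nonempty → (∀ x ∈ D, x ∉ S) →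
      (∀ x ∈ D, ∀ y, y ∉ D → y ∉ S → ¬ G.Adj x y) →
      ∃ f : V → Fin 6, (∀ u ∈ Dᶜ, ∀ v ∈ Dᶜ, G.Adj u v → f u ≠ f v) ∧ f a ≠ f b := by
    intro D hD hDS hDout
    obtain ⟨Y, hYD, hYconn, hYcl⟩ := exists_connected_subset_closed G hD
    have hY : Y.Nonempty := Set.nonempty_coe_sort.1 hYconn.nonempty
    exact hcrit.exists_coloring_on_ne (fun h => hDS a h ha) (fun h => hDS b h hb) hab hYconn
      (fun x hx h => h (hYD hx)) (hadj a ha (.inl rfl) D Y hDS hYD hY hYcl hDout)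
      (hadj b hb (.inr rfl) D Y hDS hYD hY hYcl hDout)
  by_contra! h
  obtain ⟨f, hf, hfab⟩ := hcol X hX hXS h
  obtain ⟨g, hg, hgab⟩ := hcol (X ∪ S)ᶜ ⟨z, by simp [hzS, hzX]⟩
    (fun x hx hxS => hx (Or.inr hxS)) (by
      intro x hx y hy hyS hxy
      simp only [Set.mem_compl_iff, Set.mem_union, not_or] at hx hy
      exact h y (by tauto) x hx.1 hx.2 hxy.symm)
  rw [compl_compl] at hg
  refine hcrit.not_colorable_six (colorable_of_injOn_separator h hf hg ?_ ?_)
  · intro s hs t ht hst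
    by_contra hne
    have h1 := hf s (fun h => hXS s h hs) t (fun h => hXS t h ht)
    have h2 := hS s hs t ht hne
    grind
  · intro s hs t ht hst
    by_contra hne
    have h1 := hg s (Or.inr hs) t (Or.inr ht)
    have h2 := hS s hs t ht hne
    grind

/-- A graph on few vertices is not 7-contraction-critical. -/
lemma exists_notMem_of_card_le (hcrit : ContractionCritical7 G) {S : Finset V}
    (hS : S.card ≤ 6) : ∃ v, v ∉ S := by
  by_contra! h
  have hcard : Fintype.card V ≤ 6 := by
    rw [← Finset.card_univ, ← Finset.eq_univ_of_forall h]
    exact hS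
  exact hcrit.not_colorable_six (G.colorable_of_fintype.mono hcard)

end ContractionCritical7

/-- Six vertices and one connected set forming a model of `K7vee`; the first vertex is the
end of the two missing edges. -/
lemma isMinor_K7vee_of_injective {V : Type} {G : SimpleGraph V} {v : Fin 6 → V} {Y : Set V}
    (hv : Function.Injective v)
    (hadj : ∀ i j, i < j → ¬ (i = 0 ∧ (j = 1 ∨ j = 2)) → G.Adj (v i) (v j))
    (hY : (G.induce Y).Connected) (hvY : ∀ i, v i ∉ Y) (hYv : ∀ i, ∃ y ∈ Y, G.Adj y (v i)) :
    IsMinor K7vee G := by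
  obtain ⟨bag, hlast, hcast⟩ : ∃ bag : Fin 7 → Set V,
      bag (Fin.last 6) = Y ∧ ∀ i : Fin 6, bag i.castSucc = {v i} :=
    ⟨Fin.lastCases Y fun i => {v i}, Fin.lastCases_last, fun i => Fin.lastCases_castSucc i⟩
  refine ⟨bag, fun w => ?_, fun w w' h => ?_, fun w w' h => ?_⟩
  · induction w using Fin.lastCases with
    | last => rwa [hlast]
    | cast i =>
      rw [hcast]
      exact SimpleGraph.Connected.of_subsingleton
  · induction w using Fin.lastCases with
    | last =>
      induction w' using Fin.lastCases with
      | last => exact absurd rfl h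
      | cast j => simpa only [hlast, hcast, Set.disjoint_singleton_right] using hvY j
    | cast i =>
      induction w' using Fin.lastCases with
      | last => simpa only [hlast, hcast, Set.disjoint_singleton_left] using hvY i
      | cast j =>
        rw [hcast, hcast, Set.disjoint_singleton]
        exact fun h' => h (congrArg Fin.castSucc (hv h'))
  · induction w using Fin.lastCases with
    | last =>
      induction w' using Fin.lastCases with
      | last => exact absurd h (SimpleGraph.irrefl _)
      | cast j => simpa only [hlast, hcast, Set.mem_singleton_iff, exists_eq_left] using hYv j
    | cast i =>
      induction w' using Fin.lastCases with
      | last =>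
        obtain ⟨y, hy, hyv⟩ := hYv i
        rw [hlast, hcast]
        exact ⟨v i, rfl, y, hy, hyv.symm⟩
      | cast j =>
        have hij : ∀ i j : Fin 6, K7vee.Adj i.castSucc j.castSucc →
            i < j ∧ ¬ (i = 0 ∧ (j = 1 ∨ j = 2)) ∨ j < i ∧ ¬ (j = 0 ∧ (i = 1 ∨ i = 2)) := by
          simp only [K7vee, SimpleGraph.deleteEdges_adj, completeGraph]
          decide
        rw [hcast, hcast]
        refine ⟨v i, rfl, v j, rfl, ?_⟩
        rcases hij i j h with h | h
        · exact hadj i j h.1 h.2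
        · exact (hadj j i h.1 h.2).symm

lemma isMinor_K7vee_of_cliques_sharing_triangle {V : Type} {G : SimpleGraph V}
    {t₁ t₂ t₃ a₁ a₂ b₁ b₂ : V} {Y : Set V} (hnodup : [t₁, t₂, t₃, a₁, a₂, b₁, b₂].Nodup)
    (hA : G.IsClique {t₁, t₂, t₃, a₁, a₂}) (hB : G.IsClique {t₁, t₂, t₃, b₁, b₂})
    (hY : (G.induce Y).Connected) (hb₂ : b₂ ∈ Y) (hdisj : ∀ x ∈ [t₁, t₂, t₃, a₁, a₂, b₁], x ∉ Y)
    (ha₁ : ∃ y ∈ Y, G.Adj y a₁) (ha₂ : ∃ y ∈ Y, G.Adj y a₂) :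
    IsMinor K7vee G := by
  simp only [List.nodup_cons, List.mem_cons, List.not_mem_nil, or_false, not_or] at hnodup
  simp only [SimpleGraph.isClique_insert, SimpleGraph.isClique_singleton] at hA hB
  simp only [List.mem_cons, List.not_mem_nil, or_false] at hdisj
  simp only [Set.mem_insert_iff, Set.mem_singleton_iff] at hA hB
  refine isMinor_K7vee_of_injective (v := ![b₁, a₁, a₂, t₁, t₂, t₃]) (Y := Y) ?_ ?_ hY ?_ ?_
  · have h : [b₁, a₁, a₂, t₁, t₂, t₃].Nodup := by
      simp only [List.nodup_cons, List.mem_cons, List.not_mem_nil, or_false, not_or]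
      grind
    exact List.nodup_ofFn.1 h
  · simp [Fin.forall_fin_succ]
    grind [SimpleGraph.adj_comm]
  · simp [Fin.forall_fin_succ]
    grind
  · have h : ∀ x, G.Adj b₂ x → ∃ y ∈ Y, G.Adj y x := fun x hx => ⟨b₂, hb₂, hx⟩
    simp [Fin.forall_fin_succ]
    grind [SimpleGraph.adj_comm]

/-- The union of two cliques that differ in one vertex is a clique up to one missing edge. -/
lemma adj_or_of_isClique_insert {V : Type} {G : SimpleGraph V} {K : Set V} {p q : V}
    (hp : G.IsClique (insert p K)) (hq : G.IsClique (insert q K)) :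
    ∀ s ∈ insert p (insert q K), ∀ t ∈ insert p (insert q K), s ≠ t →
      G.Adj s t ∨ s = p ∧ t = q ∨ s = q ∧ t = p := by
  rintro s (hs | hs | hs) t (ht | ht | ht) hst
  · exact absurd (hs.trans ht.symm) hst
  · exact .inr (.inl ⟨hs, ht⟩)
  · exact .inl (hp (.inl hs) (.inr ht) hst)
  · exact .inr (.inr ⟨hs, ht⟩)
  · exact absurd (hs.trans ht.symm) hst
  · exact .inl (hq (.inl hs) (.inr ht) hst)
  · exact .inl (hp (.inr hs) (.inl ht) hst)
  · exact .inl (hq (.inr hs) (.inl ht) hst)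
  · exact .inl (hp (.inr hs) (.inr ht) hst)

/-- A component outside two cliques sharing a triangle has neighbours in every pair of vertices
outside the triangle, as the remaining vertices of the two cliques do not separate. -/
lemma ContractionCritical7.exists_adj_or_exists_adj {V : Type} [Fintype V] {G : SimpleGraph V}
    (hcrit : ContractionCritical7 G) {t₁ t₂ t₃ p q r s : V} {X : Set V} (hX : X.Nonempty)
    (hnodup : [t₁, t₂, t₃, p, q, r, s].Nodup)
    (hr : G.IsClique {r, t₁, t₂, t₃}) (hs : G.IsClique {s, t₁, t₂, t₃})
    (hdisj : ∀ x ∈ [t₁, t₂, t₃, p, q, r, s], x ≠ q → x ∉ X)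
    (hnbr : ∀ x ∈ X, ∀ y, y ∉ X → G.Adj x y → y ∈ [t₁, t₂, t₃, p, q, r, s]) :
    (∃ x ∈ X, G.Adj x p) ∨ ∃ x ∈ X, G.Adj x q := by
  simp only [List.nodup_cons, List.mem_cons, List.not_mem_nil, or_false, not_or] at hnodup
  simp only [List.mem_cons, List.not_mem_nil, or_false] at hdisj hnbr
  obtain ⟨x, hx, y, hyX, hyS, hxy⟩ := hcrit.exists_adj_of_isClique_up_to_edge
    (z := p) (adj_or_of_isClique_insert hr hs) hX
    (by
      simp only [Set.mem_insert_iff, Set.mem_singleton_iff]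
      grind)
    (by
      simp only [Set.mem_insert_iff, Set.mem_singleton_iff]
      grind) (hdisj p (by simp) (by tauto))
  simp only [Set.mem_insert_iff, Set.mem_singleton_iff, not_or] at hyS
  have := hnbr x hx y hyX hxy
  have : y = p ∨ y = q := by tauto
  rcases this with rfl | rfl
  · exact .inl ⟨x, hx, hxy⟩
  · exact .inr ⟨x, hx, hxy⟩

lemma ContractionCritical7.isMinor_K7vee_of_cliques_sharing_triangle {V : Type} [Fintype V]
    {G : SimpleGraph V} (hcrit : ContractionCritical7 G) {t₁ t₂ t₃ a₁ a₂ b₁ b₂ : V}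
    (hnodup : [t₁, t₂, t₃, a₁, a₂, b₁, b₂].Nodup)
    (hA : G.IsClique {t₁, t₂, t₃, a₁, a₂}) (hB : G.IsClique {t₁, t₂, t₃, b₁, b₂}) :
    IsMinor K7vee G := by
  have hA' : G.IsClique {t₁, t₂, t₃, a₂, a₁} := by rwa [Set.pair_comm a₂ a₁]
  have hB' : G.IsClique {t₁, t₂, t₃, b₂, b₁} := by rwa [Set.pair_comm b₂ b₁]
  have ha₁ : G.IsClique {a₁, t₁, t₂, t₃} := hA.subset (by grind)
  have ha₂ : G.IsClique {a₂, t₁, t₂, t₃} := hA.subset (by grind)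
  have hb₁ : G.IsClique {b₁, t₁, t₂, t₃} := hB.subset (by grind)
  have hb₂ : G.IsClique {b₂, t₁, t₂, t₃} := hB.subset (by grind)
  obtain ⟨h₁, h₂, h₃, h₄, h₅, h₆, h₇⟩ :
      [a₁, b₁, a₂, b₂].Perm [a₁, a₂, b₁, b₂] ∧
      [a₁, b₂, a₂, b₁].Perm [a₁, a₂, b₁, b₂] ∧
      [a₂, b₁, a₁, b₂].Perm [a₁, a₂, b₁, b₂] ∧
      [a₂, b₂, a₁, b₁].Perm [a₁, a₂, b₁, b₂] ∧
      [b₁, b₂, a₁, a₂].Perm [a₁, a₂, b₁, b₂] ∧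
      [a₁, a₂, b₂, b₁].Perm [a₁, a₂, b₁, b₂] ∧
      [b₁, b₂, a₂, a₁].Perm [a₁, a₂, b₁, b₂] := by
    classical
    refine ⟨?_, ?_, ?_, ?_, ?_, ?_, ?_⟩ <;>
    · rw [List.perm_iff_count]
      intro x
      simp only [List.count_cons]
      omega
  by_cases hD : {v | v ∉ [t₁, t₂, t₃, a₁, a₂, b₁, b₂]}.Nonempty
  · obtain ⟨X, hXD, hXconn, hXcl⟩ := exists_connected_subset_closed G hD
    have hX : X.Nonempty := Set.nonempty_coe_sort.1 hXconn.nonempty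
    have hdisj : ∀ x ∈ [t₁, t₂, t₃, a₁, a₂, b₁, b₂], x ∉ X := fun x hx h => hXD h hx
    have hnbr : ∀ x ∈ X, ∀ y, y ∉ X → G.Adj x y → y ∈ [t₁, t₂, t₃, a₁, a₂, b₁, b₂] := by
      intro x hx y hy hxy
      by_contra h
      exact hy (hXcl x hx y h hxy)
    have pair : ∀ {p q r s : V}, [p, q, r, s].Perm [a₁, a₂, b₁, b₂] →
        G.IsClique {r, t₁, t₂, t₃} → G.IsClique {s, t₁, t₂, t₃} →
        (∃ x ∈ X, G.Adj x p) ∨ ∃ x ∈ X, G.Adj x q := by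
      intro p q r s hp hr hs
      have hperm := hp.append_left [t₁, t₂, t₃]
      exact hcrit.exists_adj_or_exists_adj hX (hperm.nodup_iff.2 hnodup) hr hs
        (fun x hx _ => hdisj x (hperm.mem_iff.1 hx))
        (fun x hx y hy hxy => hperm.mem_iff.2 (hnbr x hx y hy hxy))
    have triple : ∀ {a a' b b' : V}, [a, a', b, b'].Perm [a₁, a₂, b₁, b₂] →
        G.IsClique {t₁, t₂, t₃, a, a'} → G.IsClique {t₁, t₂, t₃, b, b'} →
        (∃ x ∈ X, G.Adj x a) → (∃ x ∈ X, G.Adj x a') → (∃ x ∈ X, G.Adj x b') →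
        IsMinor K7vee G := by
      rintro a a' b b' hp ha hb ⟨x, hx, hxa⟩ ⟨x', hx', hxa'⟩ ⟨x'', hx'', hxb⟩
      have hperm := hp.append_left [t₁, t₂, t₃]
      have hnd := hperm.nodup_iff.2 hnodup
      refine _root_.isMinor_K7vee_of_cliques_sharing_triangle (Y := X ∪ {b'}) hnd ha hb
        (SimpleGraph.connected_induce_union (t := {b'}) hXconn.preconnected
          (SimpleGraph.Connected.of_subsingleton).preconnected hx'' rfl hxb) (.inr rfl)
        ?_ ⟨x, .inl hx, hxa⟩ ⟨x', .inl hx', hxa'⟩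
      rintro y hy (hyX | rfl)
      · exact hdisj y (hperm.mem_iff.1 (List.mem_append_left [b'] hy)) hyX
      · exact ((List.nodup_append (l₁ := [t₁, t₂, t₃, a, a', b]) (l₂ := [y])).1 hnd).2.2
          y hy y (by simp) rfl
    have p₀ := pair (.refl _) hb₁ hb₂
    have p₁ := pair h₁ ha₂ hb₂
    have p₂ := pair h₂ ha₂ hb₁
    have p₃ := pair h₃ ha₁ hb₂
    have p₄ := pair h₄ ha₁ hb₁
    have p₅ := pair h₅ ha₁ ha₂
    have q₀ := triple (.refl _) hA hB
    have q₁ := triple h₆ hA hB'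
    have q₂ := triple h₅ hB hA
    have q₃ := triple h₇ hB hA'
    by_cases hP₁ : ∃ x ∈ X, G.Adj x a₁
    · by_cases hP₂ : ∃ x ∈ X, G.Adj x a₂
      · exact p₅.elim (q₁ hP₁ hP₂) (q₀ hP₁ hP₂)
      · exact q₃ (p₃.resolve_left hP₂) (p₄.resolve_left hP₂) hP₁
    · exact q₂ (p₁.resolve_left hP₁) (p₂.resolve_left hP₁) (p₀.resolve_left hP₁)
  · have hadj : ∀ {p r s : V}, [p, b₂, r, s].Perm [a₁, a₂, b₁, b₂] →
        G.IsClique {r, t₁, t₂, t₃} → G.IsClique {s, t₁, t₂, t₃} → G.Adj b₂ p := by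
      intro p r s hp hr hs
      have hperm := hp.append_left [t₁, t₂, t₃]
      have hnd := hperm.nodup_iff.2 hnodup
      obtain ⟨x, rfl, h⟩ | ⟨x, rfl, h⟩ := hcrit.exists_adj_or_exists_adj
        (Set.singleton_nonempty b₂) hnd hr hs (fun x _ h => h)
        (fun x hx y hy hxy => hperm.mem_iff.2 (by
          by_contra h
          exact hD ⟨y, h⟩))
      · exact h
      · exact absurd h (G.loopless.irrefl _)
    refine _root_.isMinor_K7vee_of_cliques_sharing_triangle (Y := {b₂}) hnodup hA hB
      SimpleGraph.Connected.of_subsingleton rfl ?_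
      ⟨b₂, rfl, hadj h₂ ha₂ hb₁⟩ ⟨b₂, rfl, hadj h₄ ha₁ hb₁⟩
    rintro y hy rfl
    exact ((List.nodup_append (l₁ := [t₁, t₂, t₃, a₁, a₂, b₁]) (l₂ := [y])).1 hnodup).2.2
      y hy y (by simp) rfl

lemma ContractionCritical7.isMinor_K7vee_of_cliques_sharing_four {V : Type} [Fintype V]
    {G : SimpleGraph V} (hcrit : ContractionCritical7 G) {k₁ k₂ k₃ k₄ a b : V}
    (hnodup : [a, b, k₁, k₂, k₃, k₄].Nodup)
    (hA : G.IsClique {a, k₁, k₂, k₃, k₄}) (hB : G.IsClique {b, k₁, k₂, k₃, k₄}) :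
    IsMinor K7vee G := by
  classical
  have hD : {v | v ∉ [a, b, k₁, k₂, k₃, k₄]}.Nonempty := by
    obtain ⟨v, hv⟩ := hcrit.exists_notMem_of_card_le (S := [a, b, k₁, k₂, k₃, k₄].toFinset)
      (List.toFinset_card_le _)
    exact ⟨v, fun h => hv (List.mem_toFinset.2 h)⟩
  obtain ⟨X, hXD, hXconn, hXcl⟩ := exists_connected_subset_closed G hD
  have hX : X.Nonempty := Set.nonempty_coe_sort.1 hXconn.nonempty
  have hclique : ∀ s ∈ [a, b, k₁, k₂, k₃, k₄], ∀ t ∈ [a, b, k₁, k₂, k₃, k₄], s ≠ t →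
      G.Adj s t ∨ s = a ∧ t = b ∨ s = b ∧ t = a := by
    have hunion := adj_or_of_isClique_insert hA hB
    simp only [Set.mem_insert_iff, Set.mem_singleton_iff] at hunion
    simpa only [List.mem_cons, List.not_mem_nil, or_false] using hunion
  have hnbr : ∀ c ∈ [a, b, k₁, k₂, k₃, k₄], ∃ x ∈ X, G.Adj x c := by
    intro c hc
    obtain ⟨x, hx, y, hyX, hyS, hxy⟩ := hcrit.exists_adj_of_isClique_up_to_edge
      (S := {v | v ∈ [a, b, k₁, k₂, k₃, k₄] ∧ v ≠ c})
      (fun s hs t ht hst => hclique s hs.1 t ht.1 hst) hX (fun x hx h => hXD hx h.1)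
      (z := c) (fun h => h.2 rfl) (fun h => hXD h hc)
    refine ⟨x, hx, ?_⟩
    have hy : y ∈ [a, b, k₁, k₂, k₃, k₄] := by
      by_contra h
      exact hyX (hXcl x hx y h hxy)
    have : y = c := by
      by_contra h
      exact hyS ⟨hy, h⟩
    exact this ▸ hxy
  have hv : ∀ i, ![a, b, k₁, k₂, k₃, k₄] i ∈ [a, b, k₁, k₂, k₃, k₄] := by
    simp [Fin.forall_fin_succ]
  have hinj : Function.Injective ![a, b, k₁, k₂, k₃, k₄] := List.nodup_ofFn.1 hnodup
  refine isMinor_K7vee_of_injective hinj (fun i j hij hne => ?_) hXconn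
    (fun i h => hXD h (hv i)) (fun i => hnbr _ (hv i))
  have h₀ : ![a, b, k₁, k₂, k₃, k₄] 0 = a := rfl
  have h₁ : ![a, b, k₁, k₂, k₃, k₄] 1 = b := rfl
  rcases hclique _ (hv i) _ (hv j) (hinj.ne hij.ne) with h | ⟨hi, hj⟩ | ⟨hi, hj⟩
  · exact h
  · exact absurd ⟨hinj (hi.trans h₀.symm), .inl (hinj (hj.trans h₁.symm))⟩ hne
  · rw [hinj (hi.trans h₁.symm), hinj (hj.trans h₀.symm)] at hij
    exact absurd hij (by decide)

/-- in a 7-contraction-critical graph with no `K7vee`-minor, two distinct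
5-cliques intersect in at most two vertices. -/
theorem statement_18 (V : Type) [Fintype V] [DecidableEq V] (G : SimpleGraph V)
    (hcrit : ContractionCritical7 G) (hminor : ¬ IsMinor K7vee G)
    (L₁ L₂ : Finset V) (h₁ : G.IsNClique 5 L₁) (h₂ : G.IsNClique 5 L₂)
    (hne : L₁ ≠ L₂) :
    (L₁ ∩ L₂).card ≤ 2 := by
  have hcard₁ := Finset.card_sdiff_add_card_inter L₁ L₂
  have hcard₂ := Finset.card_sdiff_add_card_inter L₂ L₁
  rw [h₁.2] at hcard₁
  rw [h₂.2, Finset.inter_comm] at hcard₂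
  have hpos : (L₁ \ L₂).card ≠ 0 := by
    intro h
    have hsub : L₁ ⊆ L₂ := Finset.sdiff_eq_empty_iff_subset.1 (Finset.card_eq_zero.1 h)
    exact hne (Finset.eq_of_subset_of_card_le hsub (by rw [h₁.2, h₂.2]))
  by_contra! hlt
  apply hminor
  obtain h3 | h4 : (L₁ ∩ L₂).card = 3 ∨ (L₁ ∩ L₂).card = 4 := by omega
  · obtain ⟨t₁, t₂, t₃, h12, h13, h23, hT⟩ := Finset.card_eq_three.1 h3
    obtain ⟨a₁, a₂, ha, hA⟩ := (Finset.card_eq_two (s := L₁ \ L₂)).1 (by omega)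
    obtain ⟨b₁, b₂, hb, hB⟩ := (Finset.card_eq_two (s := L₂ \ L₁)).1 (by omega)
    simp only [Finset.ext_iff, Finset.mem_inter, Finset.mem_sdiff, Finset.mem_insert,
      Finset.mem_singleton] at hT hA hB
    refine hcrit.isMinor_K7vee_of_cliques_sharing_triangle
      (t₁ := t₁) (t₂ := t₂) (t₃ := t₃) (a₁ := a₁) (a₂ := a₂) (b₁ := b₁) (b₂ := b₂) ?_
      (h₁.1.subset ?_) (h₂.1.subset ?_)
    · have ht₁ := (hT t₁).2 (by simp)
      have ht₂ := (hT t₂).2 (by simp)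
      have ht₃ := (hT t₃).2 (by simp)
      have ha₁ := (hA a₁).2 (by simp)
      have ha₂ := (hA a₂).2 (by simp)
      have hb₁ := (hB b₁).2 (by simp)
      have hb₂ := (hB b₂).2 (by simp)
      clear hT hA hB hcrit h₁ h₂ hcard₁ hcard₂ h3 hlt hpos hne
      simp only [List.nodup_cons, List.mem_cons, List.not_mem_nil, or_false, not_or]
      grind (splits := 30)
    · intro x hx
      simp only [Set.mem_insert_iff, Set.mem_singleton_iff] at hx
      grind
    · intro x hx
      simp only [Set.mem_insert_iff, Set.mem_singleton_iff] at hx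
      grind
  · obtain ⟨k₁, k₂, k₃, k₄, h12, h13, h14, h23, h24, h34, hK⟩ := Finset.card_eq_four.1 h4
    obtain ⟨a, hA⟩ := (Finset.card_eq_one (s := L₁ \ L₂)).1 (by omega)
    obtain ⟨b, hB⟩ := (Finset.card_eq_one (s := L₂ \ L₁)).1 (by omega)
    simp only [Finset.ext_iff, Finset.mem_inter, Finset.mem_sdiff, Finset.mem_insert,
      Finset.mem_singleton] at hK hA hB
    refine hcrit.isMinor_K7vee_of_cliques_sharing_four
      (k₁ := k₁) (k₂ := k₂) (k₃ := k₃) (k₄ := k₄) (a := a) (b := b) ?_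
      (h₁.1.subset ?_) (h₂.1.subset ?_)
    · simp only [List.nodup_cons, List.mem_cons, List.not_mem_nil, or_false, not_or]
      grind
    · intro x hx
      simp only [Set.mem_insert_iff, Set.mem_singleton_iff] at hx
      grind
    · intro x hx
      simp only [Set.mem_insert_iff, Set.mem_singleton_iff] at hx
      grind
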